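/- (Finite-blocklength guessing version, achievability.) For every triple (c_s, c₁, c₂) of positive integers satisfying c_s ≤ min(|𝒨₁|, |𝒨₂|), c₁ ≤ ⌊|𝒨₁|/c_s⌋, and c₂ ≤ ⌊|𝒨₂|/c_s⌋, there is a choice of Alice's encoder (a conditional PMF P(M₁ = m₁, M₂ = m₂ | X = x, Y = y)) for which Bob's guessing ambiguity satisfies 𝒜_B^g < 1 + 2^{ρ(H_{1/(1+ρ)}(X|Y) − log(c_s c₁ c₂) + 1)} and Eve's ambiguity satisfies 𝒜_E ≥ (1 + ln|𝒳|)^{−ρ} · 2^{ρ(H_{1/(1+ρ)}(X|Y) − log(c₁ + c₂))}. -/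

import Mathlib

open scoped BigOperators

noncomputable section

/-- `G` is a guessing function for `X` given side information in `V`:
for every `v`, `G v` is a bijection from `X` onto `{1, …, |X|}`. -/
def IsGuess {X V : Type*} [Fintype X] (G : V → X → ℕ) : Prop :=
  ∀ v : V, Set.BijOn (G v) Set.univ (Set.Icc 1 (Fintype.card X))

/-- The conditional Rényi entropy `H_α(X|Y)` (base 2) of order `α = 1/(1+ρ)`. -/
def condRenyi {X Y : Type*} [Fintype X] [Fintype Y] (ρ : ℝ) (p : X → Y → ℝ) : ℝ :=
  ((1 / (1 + ρ)) / (1 - 1 / (1 + ρ))) *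
    Real.logb 2 (∑ y : Y, (∑ x : X, p x y ^ (1 / (1 + ρ))) ^ (1 / (1 / (1 + ρ))))

/-- Bob's guessing ambiguity `𝒜_B^g`: the least ρ-th moment of the number of guesses that
Bob, observing `(Y, M₁, M₂)`, needs to guess `X`. -/
def bobGuessAmb {𝒳 𝒴 M₁ M₂ : Type*} [Fintype 𝒳] [Fintype 𝒴] [Fintype M₁] [Fintype M₂]
    (ρ : ℝ) (p : 𝒳 → 𝒴 → ℝ) (e : 𝒳 → 𝒴 → M₁ × M₂ → ℝ) : ℝ :=
  sInf {r : ℝ | ∃ G : 𝒴 × M₁ × M₂ → 𝒳 → ℕ, IsGuess G ∧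
    r = ∑ x : 𝒳, ∑ y : 𝒴, ∑ m : M₁ × M₂, p x y * e x y m * (G (y, m) x : ℝ) ^ ρ}

/-- Bob's list ambiguity `𝒜_B^l`: the ρ-th moment of the size of the list of realizations
of `X` with positive posterior probability given `(Y, M₁, M₂)`. -/
def bobListAmb {𝒳 𝒴 M₁ M₂ : Type*} [Fintype 𝒳] [Fintype 𝒴] [Fintype M₁] [Fintype M₂]
    (ρ : ℝ) (p : 𝒳 → 𝒴 → ℝ) (e : 𝒳 → 𝒴 → M₁ × M₂ → ℝ) : ℝ :=
  ∑ x : 𝒳, ∑ y : 𝒴, ∑ m : M₁ × M₂, p x y * e x y m *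
    (((Finset.univ.filter fun x' : 𝒳 => 0 < p x' y * e x' y m).card : ℝ)) ^ ρ

/-- Eve's ambiguity `𝒜_E`: the least ρ-th moment of the number of guesses, where for every
realization the more informative of the two hints is used. -/
def eveAmb {𝒳 𝒴 M₁ M₂ : Type*} [Fintype 𝒳] [Fintype 𝒴] [Fintype M₁] [Fintype M₂]
    (ρ : ℝ) (p : 𝒳 → 𝒴 → ℝ) (e : 𝒳 → 𝒴 → M₁ × M₂ → ℝ) : ℝ :=
  sInf {r : ℝ | ∃ G₁ : 𝒴 × M₁ → 𝒳 → ℕ, ∃ G₂ : 𝒴 × M₂ → 𝒳 → ℕ, IsGuess G₁ ∧ IsGuess G₂ ∧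
    r = ∑ x : 𝒳, ∑ y : 𝒴, ∑ m₁ : M₁, ∑ m₂ : M₂, p x y * e x y (m₁, m₂) *
      ((min (G₁ (y, m₁) x) (G₂ (y, m₂) x) : ℕ) : ℝ) ^ ρ}

/-- The alternative (less conservative) Eve ambiguity `Ã_E`. -/
def eveAmbAlt {𝒳 𝒴 M₁ M₂ : Type*} [Fintype 𝒳] [Fintype 𝒴] [Fintype M₁] [Fintype M₂]
    (ρ : ℝ) (p : 𝒳 → 𝒴 → ℝ) (e : 𝒳 → 𝒴 → M₁ × M₂ → ℝ) : ℝ :=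
  min
    (sInf {r : ℝ | ∃ G₁ : 𝒴 × M₁ → 𝒳 → ℕ, IsGuess G₁ ∧
      r = ∑ x : 𝒳, ∑ y : 𝒴, ∑ m₁ : M₁, ∑ m₂ : M₂, p x y * e x y (m₁, m₂) *
        (G₁ (y, m₁) x : ℝ) ^ ρ})
    (sInf {r : ℝ | ∃ G₂ : 𝒴 × M₂ → 𝒳 → ℕ, IsGuess G₂ ∧
      r = ∑ x : 𝒳, ∑ y : 𝒴, ∑ m₁ : M₁, ∑ m₂ : M₂, p x y * e x y (m₁, m₂) *
        (G₂ (y, m₂) x : ℝ) ^ ρ})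

/-- Sorting a finite type by a weight produces a guessing order in which every element appears
no later than the number of elements of at most its own weight. -/
lemma exists_bijOn_le_card {X : Type*} [Fintype X] (w : X → ℝ) :
    ∃ g : X → ℕ, Set.BijOn g Set.univ (Set.Icc 1 (Fintype.card X)) ∧
      ∀ x, g x ≤ (Finset.univ.filter fun x' => w x' ≤ w x).card := by
  classical
  let e := Fintype.equivFin X
  let σ := Tuple.sort (w ∘ e.symm)
  have hmono : Monotone ((w ∘ e.symm) ∘ σ) := Tuple.monotone_sort _
  let τ : X ≃ Fin (Fintype.card X) := e.trans σ.symm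
  have hw (i) : ((w ∘ e.symm) ∘ σ) i = w (τ.symm i) := by simp [τ]
  refine ⟨fun x => (τ x : ℕ) + 1, ⟨?_, ?_, ?_⟩, fun x => ?_⟩
  · intro x _
    have := (τ x).2
    simp only [Set.mem_Icc]
    omega
  · intro x _ x' _ h
    apply τ.injective
    ext
    simpa using h
  · intro k hk
    simp only [Set.mem_Icc] at hk
    exact ⟨τ.symm ⟨k - 1, by omega⟩, trivial, by simp; omega⟩
  · have hsub : (Finset.Iic (τ x)).map τ.symm.toEmbedding ⊆
        Finset.univ.filter fun x' => w x' ≤ w x := by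
      intro x' hx'
      simp only [Finset.mem_map, Finset.mem_Iic, Equiv.coe_toEmbedding] at hx'
      obtain ⟨i, hi, rfl⟩ := hx'
      have h := hmono hi
      rw [hw, hw, Equiv.symm_apply_apply] at h
      simpa using h
    simpa using Finset.card_le_card hsub

lemma exists_isGuess (X V : Type*) [Fintype X] : ∃ G : V → X → ℕ, IsGuess G := by
  obtain ⟨g, hg, -⟩ := exists_bijOn_le_card (fun _ : X => (0 : ℝ))
  exact ⟨fun _ => g, fun _ => hg⟩

/-- Arikan's upper bound on the `ρ`-th moment of the optimal guess. -/
lemma sum_mul_rpow_guess_le {X : Type*} [Fintype X] {ρ : ℝ} (hρ : 0 < ρ) (q : X → ℝ)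
    (hq : ∀ x, 0 ≤ q x) (g : X → ℕ)
    (hg : ∀ x, g x ≤ (Finset.univ.filter fun x' => -q x' ≤ -q x).card) :
    ∑ x, q x * (g x : ℝ) ^ ρ ≤ (∑ x, q x ^ (1 / (1 + ρ))) ^ (1 + ρ) := by
  set α : ℝ := 1 / (1 + ρ) with hα
  have hα0 : 0 < α := by positivity
  set S : ℝ := ∑ x, q x ^ α
  have hS : 0 ≤ S := Finset.sum_nonneg fun x _ => Real.rpow_nonneg (hq x) _
  have key (x) : q x * (g x : ℝ) ^ ρ ≤ q x ^ α * S ^ ρ := by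
    rcases (hq x).eq_or_lt with h | h
    · rw [← h, zero_mul]; positivity
    have hcard : q x ^ α * (g x : ℝ) ≤ S := by
      calc q x ^ α * (g x : ℝ)
          ≤ q x ^ α * ((Finset.univ.filter fun x' => -q x' ≤ -q x).card : ℝ) := by
            gcongr; exact hg x
        _ = ∑ x' ∈ Finset.univ.filter (fun x' => -q x' ≤ -q x), q x ^ α := by
            rw [Finset.sum_const, nsmul_eq_mul, mul_comm]
        _ ≤ ∑ x' ∈ Finset.univ.filter (fun x' => -q x' ≤ -q x), q x' ^ α := by
            refine Finset.sum_le_sum fun x' hx' => ?_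
            rw [Finset.mem_filter] at hx'
            exact Real.rpow_le_rpow h.le (by linarith [hx'.2]) hα0.le
        _ ≤ S := Finset.sum_le_sum_of_subset_of_nonneg (Finset.filter_subset _ _)
            fun x' _ _ => Real.rpow_nonneg (hq x') _
    have hsplit : q x = q x ^ α * (q x ^ α) ^ ρ := by
      rw [← Real.rpow_mul h.le, ← Real.rpow_add h]
      have : α + α * ρ = 1 := by rw [hα]; field_simp
      rw [this, Real.rpow_one]
    calc q x * (g x : ℝ) ^ ρ = q x ^ α * (q x ^ α * (g x : ℝ)) ^ ρ := by
          rw [Real.mul_rpow (by positivity) (by positivity), ← mul_assoc, ← hsplit]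
      _ ≤ q x ^ α * S ^ ρ := by gcongr
  calc ∑ x, q x * (g x : ℝ) ^ ρ ≤ ∑ x, q x ^ α * S ^ ρ := Finset.sum_le_sum fun x _ => key x
    _ = S ^ (1 + ρ) := by
        rw [← Finset.sum_mul, Real.rpow_add' hS (by positivity), Real.rpow_one]

/-- Hölder's inequality in the form used for lower bounds on guessing moments. -/
lemma rpow_sum_rpow_le {ι : Type*} [Fintype ι] {ρ : ℝ} (hρ : 0 < ρ) (q w : ι → ℝ)
    (hq : ∀ i, 0 ≤ q i) (hw : ∀ i, 0 < w i) :
    (∑ i, q i ^ (1 / (1 + ρ))) ^ (1 + ρ) ≤ (∑ i, q i * w i ^ ρ) * (∑ i, (w i)⁻¹) ^ ρ := by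
  have hρ1 : (1 + ρ) ≠ 0 := by positivity
  have hconj : (1 + ρ).HolderConjugate ((1 + ρ) / ρ) := by
    rw [Real.holderConjugate_iff]
    exact ⟨by linarith, by field_simp⟩
  have hA (i) : 0 ≤ q i * w i ^ ρ := mul_nonneg (hq i) (Real.rpow_nonneg (hw i).le _)
  have hB (i) : 0 ≤ (w i)⁻¹ := (inv_pos.2 (hw i)).le
  have h := Real.inner_le_Lp_mul_Lq_of_nonneg Finset.univ hconj
    (f := fun i => (q i * w i ^ ρ) ^ (1 / (1 + ρ))) (g := fun i => (w i)⁻¹ ^ (ρ / (1 + ρ)))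
    (fun i _ => Real.rpow_nonneg (hA i) _) (fun i _ => Real.rpow_nonneg (hB i) _)
  have e1 (i) : (q i * w i ^ ρ) ^ (1 / (1 + ρ)) * (w i)⁻¹ ^ (ρ / (1 + ρ)) =
      q i ^ (1 / (1 + ρ)) := by
    rw [Real.mul_rpow (hq i) (Real.rpow_nonneg (hw i).le _), ← Real.rpow_mul (hw i).le,
      Real.inv_rpow (hw i).le, mul_one_div]
    exact mul_inv_cancel_right₀ (Real.rpow_pos_of_pos (hw i) _).ne' _
  have e2 (i) : ((q i * w i ^ ρ) ^ (1 / (1 + ρ))) ^ (1 + ρ) = q i * w i ^ ρ := by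
    rw [← Real.rpow_mul (hA i), one_div_mul_cancel hρ1, Real.rpow_one]
  have e3 (i) : ((w i)⁻¹ ^ (ρ / (1 + ρ))) ^ ((1 + ρ) / ρ) = (w i)⁻¹ := by
    rw [← Real.rpow_mul (hB i), show ρ / (1 + ρ) * ((1 + ρ) / ρ) = 1 by field_simp,
      Real.rpow_one]
  simp only [e1, e2, e3] at h
  have hA' : 0 ≤ ∑ i, q i * w i ^ ρ := Finset.sum_nonneg fun i _ => hA i
  have hB' : 0 ≤ ∑ i, (w i)⁻¹ := Finset.sum_nonneg fun i _ => hB i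
  calc (∑ i, q i ^ (1 / (1 + ρ))) ^ (1 + ρ)
      ≤ ((∑ i, q i * w i ^ ρ) ^ (1 / (1 + ρ)) *
          (∑ i, (w i)⁻¹) ^ (1 / ((1 + ρ) / ρ))) ^ (1 + ρ) :=
        Real.rpow_le_rpow (Finset.sum_nonneg fun i _ => Real.rpow_nonneg (hq i) _) h
          (by positivity)
    _ = _ := by
        rw [Real.mul_rpow (by positivity) (by positivity), ← Real.rpow_mul hA',
          ← Real.rpow_mul hB', one_div_mul_cancel hρ1, Real.rpow_one,
          show 1 / ((1 + ρ) / ρ) * (1 + ρ) = ρ by field_simp]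

/-- If every positive integer is attained at most `N` times by `g`, then the reciprocals of `g`
sum to at most `N` times a harmonic number. -/
lemma sum_inv_le_of_card_fiber_le {ι : Type*} [Fintype ι] (g : ι → ℕ) (n N : ℕ)
    (hg : ∀ i, g i ∈ Finset.Icc 1 n)
    (hN : ∀ k, (Finset.univ.filter fun i => g i = k).card ≤ N) :
    ∑ i, ((g i : ℝ))⁻¹ ≤ N * (1 + Real.log n) := by
  rw [← Finset.sum_fiberwise_of_maps_to (t := Finset.Icc 1 n) (fun i _ => hg i)]
  have hk (k : ℕ) : ∑ i ∈ Finset.univ.filter (fun i => g i = k), ((g i : ℝ))⁻¹ ≤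
      N * (k : ℝ)⁻¹ := by
    rw [Finset.sum_congr rfl (g := fun _ => (k : ℝ)⁻¹)
      (fun i hi => by rw [(Finset.mem_filter.1 hi).2]), Finset.sum_const, nsmul_eq_mul]
    gcongr
    exact hN k
  calc _ ≤ ∑ k ∈ Finset.Icc 1 n, (N : ℝ) * (k : ℝ)⁻¹ := Finset.sum_le_sum fun k _ => hk k
    _ = N * ((harmonic n : ℚ) : ℝ) := by
        rw [← Finset.mul_sum, harmonic_eq_sum_Icc]
        push_cast
        rfl
    _ ≤ _ := by gcongr; exact harmonic_le_one_add_log n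

/-- The encoder that draws a uniform key `u` and outputs the hint `enc x y u`. -/
def keyedEncoder {𝒳 𝒴 K M : Type*} [Fintype K] (enc : 𝒳 → 𝒴 → K → M) (x : 𝒳) (y : 𝒴) (m : M) :
    ℝ :=
  open Classical in (Fintype.card K : ℝ)⁻¹ * ∑ u : K, if m = enc x y u then 1 else 0

lemma keyedEncoder_nonneg {𝒳 𝒴 K M : Type*} [Fintype K] (enc : 𝒳 → 𝒴 → K → M)
    (x : 𝒳) (y : 𝒴) (m : M) : 0 ≤ keyedEncoder enc x y m := by
  unfold keyedEncoder
  exact mul_nonneg (by positivity) (Finset.sum_nonneg fun u _ => by split_ifs <;> norm_num)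

lemma sum_keyedEncoder_mul {𝒳 𝒴 K M : Type*} [Fintype K] [Fintype M] (enc : 𝒳 → 𝒴 → K → M)
    (x : 𝒳) (y : 𝒴) (F : M → ℝ) :
    ∑ m, keyedEncoder enc x y m * F m = (Fintype.card K : ℝ)⁻¹ * ∑ u, F (enc x y u) := by
  classical
  unfold keyedEncoder
  simp only [mul_assoc, ← Finset.mul_sum, Finset.sum_mul]
  rw [Finset.sum_comm]
  simp

lemma sum_keyedEncoder {𝒳 𝒴 K M : Type*} [Fintype K] [Nonempty K] [Fintype M]
    (enc : 𝒳 → 𝒴 → K → M) (x : 𝒳) (y : 𝒴) : ∑ m, keyedEncoder enc x y m = 1 := by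
  simpa using sum_keyedEncoder_mul enc x y fun _ => 1

lemma sum_keyedEncoder_mul_mul {𝒳 𝒴 K M : Type*} [Fintype K] [Fintype M] (enc : 𝒳 → 𝒴 → K → M)
    (x : 𝒳) (y : 𝒴) (a : ℝ) (F : M → ℝ) :
    ∑ m, a * keyedEncoder enc x y m * F m =
      a * ((Fintype.card K : ℝ)⁻¹ * ∑ u, F (enc x y u)) := by
  simp only [mul_assoc, ← Finset.mul_sum, sum_keyedEncoder_mul]

/-- The hint pair for the description `t = (s, a, b)` under the one-time pad `u`: the secret part
`s` is stored encrypted in the first hint, its key in the second. -/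
def padHints {K A B M₁ M₂ : Type*} [Add K] (ι₁ : K × A ↪ M₁) (ι₂ : K × B ↪ M₂) (t : K × A × B)
    (u : K) : M₁ × M₂ :=
  (ι₁ (t.1 + u, t.2.1), ι₂ (u, t.2.2))

lemma padHints_eq_imp {K A B M₁ M₂ : Type*} [AddGroup K] (ι₁ : K × A ↪ M₁) (ι₂ : K × B ↪ M₂)
    {t t' : K × A × B} {u u' : K} (h : padHints ι₁ ι₂ t u = padHints ι₁ ι₂ t' u') : t = t' := by
  obtain ⟨s, a, b⟩ := t
  obtain ⟨s', a', b'⟩ := t'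
  simp only [padHints, Prod.mk.injEq, EmbeddingLike.apply_eq_iff_eq] at h
  obtain ⟨⟨h1, rfl⟩, rfl, rfl⟩ := h
  rw [add_right_cancel h1]

/-- Each number of guesses is attained by few (source symbol, key) pairs. -/
lemma card_min_guess_eq_le {X K A B M₁ M₂ : Type*} [Fintype X] [Fintype K] [Fintype A]
    [Fintype B] [AddGroup K] (ι₁ : K × A ↪ M₁) (ι₂ : K × B ↪ M₂) (f : X → K × A × B)
    (G₁ : M₁ → X → ℕ) (G₂ : M₂ → X → ℕ) (h₁ : ∀ m, (G₁ m).Injective)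
    (h₂ : ∀ m, (G₂ m).Injective) (k : ℕ) :
    (Finset.univ.filter fun i : X × K =>
      min (G₁ (padHints ι₁ ι₂ (f i.1) i.2).1 i.1) (G₂ (padHints ι₁ ι₂ (f i.1) i.2).2 i.1) =
        k).card ≤ Fintype.card K * (Fintype.card A + Fintype.card B) := by
  classical
  have c1 : (Finset.univ.filter fun i : X × K =>
      G₁ (padHints ι₁ ι₂ (f i.1) i.2).1 i.1 = k).card ≤ Fintype.card (K × A) := by
    refine Finset.card_le_card_of_injOn (fun i => ((f i.1).1 + i.2, (f i.1).2.1))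
      (fun _ _ => Finset.mem_coe.2 (Finset.mem_univ _)) ?_
    rintro ⟨x, u⟩ hx ⟨x', u'⟩ hx' h
    replace hx := (Finset.mem_filter.1 (Finset.mem_coe.1 hx)).2
    replace hx' := (Finset.mem_filter.1 (Finset.mem_coe.1 hx')).2
    simp only [padHints] at hx hx' h
    rw [← h, ← hx] at hx'
    obtain rfl := h₁ _ hx'
    simpa using h
  have c2 : (Finset.univ.filter fun i : X × K =>
      G₂ (padHints ι₁ ι₂ (f i.1) i.2).2 i.1 = k).card ≤ Fintype.card (K × B) := by
    refine Finset.card_le_card_of_injOn (fun i => (i.2, (f i.1).2.2))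
      (fun _ _ => Finset.mem_coe.2 (Finset.mem_univ _)) ?_
    rintro ⟨x, u⟩ hx ⟨x', u'⟩ hx' h
    replace hx := (Finset.mem_filter.1 (Finset.mem_coe.1 hx)).2
    replace hx' := (Finset.mem_filter.1 (Finset.mem_coe.1 hx')).2
    simp only [padHints] at hx hx' h
    rw [← h, ← hx] at hx'
    obtain rfl := h₂ _ hx'
    simpa using h
  rw [Fintype.card_prod] at c1 c2
  rw [mul_add]
  refine le_trans ((Finset.card_le_card ?_).trans (Finset.card_union_le _ _)) (add_le_add c1 c2)
  intro i hi
  simp only [Finset.mem_filter, Finset.mem_univ, true_and, Finset.mem_union] at hi ⊢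
  rcases min_choice (G₁ (padHints ι₁ ι₂ (f i.1) i.2).1 i.1)
    (G₂ (padHints ι₁ ι₂ (f i.1) i.2).2 i.1) with h | h
  · exact Or.inl (h.symm.trans hi)
  · exact Or.inr (h.symm.trans hi)

/-- Eve's ambiguity for one realization of the side information. -/
lemma rpow_sum_rpow_le_min_guess {X K A B M₁ M₂ : Type*} [Fintype X] [Fintype K] [Fintype A]
    [Fintype B] [AddGroup K] {ρ : ℝ} (hρ : 0 < ρ) (q : X → ℝ) (hq : ∀ x, 0 ≤ q x)
    (ι₁ : K × A ↪ M₁) (ι₂ : K × B ↪ M₂) (f : X → K × A × B)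
    (G₁ : M₁ → X → ℕ) (G₂ : M₂ → X → ℕ) (h₁ : IsGuess G₁) (h₂ : IsGuess G₂) :
    (∑ x, q x ^ (1 / (1 + ρ))) ^ (1 + ρ) ≤
      (∑ x, q x * ((Fintype.card K : ℝ)⁻¹ * ∑ u,
        ((min (G₁ (padHints ι₁ ι₂ (f x) u).1 x) (G₂ (padHints ι₁ ι₂ (f x) u).2 x) : ℕ) : ℝ) ^ ρ)) *
      (((Fintype.card A + Fintype.card B : ℕ) : ℝ) * (1 + Real.log (Fintype.card X))) ^ ρ := by
  set g : X × K → ℕ := fun i =>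
    min (G₁ (padHints ι₁ ι₂ (f i.1) i.2).1 i.1) (G₂ (padHints ι₁ ι₂ (f i.1) i.2).2 i.1) with hg
  have hmem (i) : g i ∈ Finset.Icc 1 (Fintype.card X) := by
    have a1 := (h₁ (padHints ι₁ ι₂ (f i.1) i.2).1).mapsTo (Set.mem_univ i.1)
    have a2 := (h₂ (padHints ι₁ ι₂ (f i.1) i.2).2).mapsTo (Set.mem_univ i.1)
    simp only [Set.mem_Icc] at a1 a2
    simp only [hg, Finset.mem_Icc]
    omega
  have hinv := sum_inv_le_of_card_fiber_le g _ _ hmem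
    (card_min_guess_eq_le ι₁ ι₂ f G₁ G₂ (fun m => Set.injOn_univ.1 (h₁ m).injOn)
      (fun m => Set.injOn_univ.1 (h₂ m).injOn))
  have hH := rpow_sum_rpow_le hρ (fun i : X × K => q i.1) (fun i => (g i : ℝ))
    (fun i => hq i.1) (fun i => by exact_mod_cast (Finset.mem_Icc.1 (hmem i)).1)
  set S : ℝ := ∑ x, q x ^ (1 / (1 + ρ)) with hS
  have hS0 : 0 ≤ S := Finset.sum_nonneg fun x _ => Real.rpow_nonneg (hq x) _
  have hL : 0 ≤ 1 + Real.log (Fintype.card X) := by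
    have := Real.log_natCast_nonneg (Fintype.card X)
    positivity
  set κ : ℝ := (Fintype.card K : ℝ) with hκ
  have hκ0 : 0 < κ := Nat.cast_pos.2 Fintype.card_pos
  have e1 : ∑ i : X × K, q i.1 ^ (1 / (1 + ρ)) = κ * S := by
    simp [Fintype.sum_prod_type, hS, Finset.mul_sum, hκ]
  have e2 : ∑ i : X × K, q i.1 * (g i : ℝ) ^ ρ =
      κ * ∑ x, q x * (κ⁻¹ * ∑ u, (g (x, u) : ℝ) ^ ρ) := by
    rw [Fintype.sum_prod_type, Finset.mul_sum]
    refine Finset.sum_congr rfl fun x _ => ?_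
    simp only [← Finset.mul_sum]
    field_simp
  rw [e1, e2] at hH
  have hE0 : 0 ≤ ∑ x, q x * (κ⁻¹ * ∑ u, (g (x, u) : ℝ) ^ ρ) :=
    Finset.sum_nonneg fun x _ => mul_nonneg (hq x) (by positivity)
  set E : ℝ := ∑ x, q x * (κ⁻¹ * ∑ u, (g (x, u) : ℝ) ^ ρ)
  set C : ℝ := ((Fintype.card A + Fintype.card B : ℕ) : ℝ) * (1 + Real.log (Fintype.card X))
    with hC
  have hC0 : 0 ≤ C := by positivity
  have hle : (κ * S) ^ (1 + ρ) ≤ (κ * E) * (κ * C) ^ ρ := by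
    refine hH.trans (mul_le_mul_of_nonneg_left ?_ (by positivity))
    refine Real.rpow_le_rpow (Finset.sum_nonneg fun i _ => by positivity) ?_ hρ.le
    refine hinv.trans (le_of_eq ?_)
    rw [hC, hκ]
    push_cast
    ring
  rw [Real.mul_rpow hκ0.le hS0, Real.mul_rpow hκ0.le hC0, Real.rpow_add hκ0, Real.rpow_one]
    at hle
  have hκρ : 0 < κ * κ ^ ρ := by positivity
  refine le_of_mul_le_mul_left ?_ hκρ
  calc _ ≤ _ := hle
    _ = _ := by ring

lemma rpow_nat_div_add_one_lt {ρ : ℝ} (hρ : 0 < ρ) (g c : ℕ) (hg : 0 < g) (hc : 0 < c) :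
    (((g - 1) / c + 1 : ℕ) : ℝ) ^ ρ < 1 + 2 ^ ρ * (c : ℝ) ^ (-ρ) * (g : ℝ) ^ ρ := by
  have hg' : (0 : ℝ) < g := by exact_mod_cast hg
  have hc' : (0 : ℝ) < c := by exact_mod_cast hc
  rcases Nat.eq_zero_or_pos ((g - 1) / c) with h | h
  · rw [h]
    simp only [zero_add, Nat.cast_one, Real.one_rpow, lt_add_iff_pos_right]
    positivity
  · have h1 : (((g - 1) / c + 1 : ℕ) : ℝ) ≤ 2 * (c : ℝ)⁻¹ * g := by
      rw [mul_assoc, inv_mul_eq_div, ← mul_div_assoc, le_div_iff₀ hc']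
      have h2 : (g - 1) / c * c ≤ g - 1 := Nat.div_mul_le_self _ _
      have h3 : ((g - 1) / c + 1) * c ≤ 2 * g := by nlinarith [Nat.sub_le g 1]
      exact_mod_cast h3
    calc _ ≤ (2 * (c : ℝ)⁻¹ * g) ^ ρ := Real.rpow_le_rpow (by positivity) h1 hρ.le
      _ = 2 ^ ρ * (c : ℝ) ^ (-ρ) * (g : ℝ) ^ ρ := by
        rw [Real.mul_rpow (by positivity) hg'.le, Real.mul_rpow (by norm_num) (by positivity),
          Real.inv_rpow hc'.le, Real.rpow_neg hc'.le]
      _ < _ := by linarith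

/-- Given a guessing order `g` and a hint that reveals the residue of `g - 1` modulo `c`, there is a
guessing order for every hint that skips the symbols inconsistent with it. -/
lemma exists_guess_of_residue_hint {X K M : Type*} [Fintype X] (g : X → ℕ)
    (hg : Set.BijOn g Set.univ (Set.Icc 1 (Fintype.card X))) (c : ℕ)
    (enc : X → K → M)
    (henc : ∀ x x' u u', enc x u = enc x' u' → (g x - 1) % c = (g x' - 1) % c) :
    ∃ G : M → X → ℕ, IsGuess G ∧ ∀ x u, G (enc x u) x ≤ (g x - 1) / c + 1 := by
  classical
  let w (m : M) (x : X) : ℝ := if ∃ u, enc x u = m then g x else Fintype.card X + 1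
  choose G hG hle using fun m => exists_bijOn_le_card (w m)
  refine ⟨G, hG, fun x u => (hle _ x).trans ?_⟩
  have hg1 (x) : 1 ≤ g x ∧ g x ≤ Fintype.card X := by simpa using hg.mapsTo (Set.mem_univ x)
  have hwx : w (enc x u) x = g x := if_pos ⟨u, rfl⟩
  have hmem (x') (h : w (enc x u) x' ≤ w (enc x u) x) :
      (g x' - 1) % c = (g x - 1) % c ∧ g x' ≤ g x := by
    rw [hwx] at h
    by_cases hx' : ∃ u', enc x' u' = enc x u
    · obtain ⟨u', hu'⟩ := hx'
      have : w (enc x u) x' = g x' := if_pos ⟨u', hu'⟩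
      rw [this] at h
      exact ⟨henc _ _ _ _ hu', by exact_mod_cast h⟩
    · have : w (enc x u) x' = Fintype.card X + 1 := if_neg hx'
      rw [this] at h
      have h' : Fintype.card X + 1 ≤ g x := by exact_mod_cast h
      have := (hg1 x).2
      omega
  rw [← Finset.card_range ((g x - 1) / c + 1)]
  refine Finset.card_le_card_of_injOn (fun x' => (g x' - 1) / c) ?_ ?_
  · intro x' hx'
    simp only [Finset.coe_filter, Finset.mem_univ, true_and, Set.mem_ofPred_eq] at hx'
    simp only [Finset.coe_range, Set.mem_Iio]
    exact Nat.lt_succ_of_le (Nat.div_le_div_right (Nat.sub_le_sub_right (hmem x' hx').2 1))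
  · intro a ha b hb hab
    simp only [Finset.coe_filter, Finset.mem_univ, true_and, Set.mem_ofPred_eq] at ha hb
    have h1 := (hmem a ha).1.trans (hmem b hb).1.symm
    have h2 : g a - 1 = g b - 1 := by
      rw [← Nat.div_add_mod (g a - 1) c, ← Nat.div_add_mod (g b - 1) c, h1]
      simp only at hab
      rw [hab]
    have h3 := (hg1 a).1
    have h4 := (hg1 b).1
    exact hg.injOn (Set.mem_univ a) (Set.mem_univ b) (by omega)

lemma sum_rpow_sum_rpow_pos {X Y : Type*} [Fintype X] [Fintype Y] (ρ : ℝ) (p : X → Y → ℝ)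
    (hp0 : ∀ x y, 0 ≤ p x y) (hp1 : ∑ x, ∑ y, p x y = 1) :
    0 < ∑ y, (∑ x, p x y ^ (1 / (1 + ρ))) ^ (1 + ρ) := by
  have hS (y) : 0 ≤ ∑ x, p x y ^ (1 / (1 + ρ)) :=
    Finset.sum_nonneg fun x _ => Real.rpow_nonneg (hp0 x y) _
  obtain ⟨x, -, hx⟩ := Finset.exists_ne_zero_of_sum_ne_zero (hp1.trans_ne one_ne_zero)
  obtain ⟨y, -, hy⟩ := Finset.exists_ne_zero_of_sum_ne_zero hx
  refine Finset.sum_pos' (fun y _ => Real.rpow_nonneg (hS y) _) ⟨y, Finset.mem_univ y, ?_⟩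
  refine Real.rpow_pos_of_pos ?_ _
  exact Finset.sum_pos' (fun x _ => Real.rpow_nonneg (hp0 x y) _)
    ⟨x, Finset.mem_univ x, Real.rpow_pos_of_pos ((hp0 x y).lt_of_ne' hy) _⟩

lemma two_rpow_mul_condRenyi {X Y : Type*} [Fintype X] [Fintype Y] {ρ : ℝ} (hρ : 0 < ρ)
    (p : X → Y → ℝ) (hp0 : ∀ x y, 0 ≤ p x y) (hp1 : ∑ x, ∑ y, p x y = 1) :
    (2 : ℝ) ^ (ρ * condRenyi ρ p) = ∑ y, (∑ x, p x y ^ (1 / (1 + ρ))) ^ (1 + ρ) := by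
  have h1 : ρ * (1 / (1 + ρ) / (1 - 1 / (1 + ρ))) = 1 := by
    have h2 : 1 - 1 / (1 + ρ) = ρ / (1 + ρ) := by field_simp; ring
    rw [h2]
    field_simp
  rw [condRenyi, ← mul_assoc, h1, one_mul, one_div_one_div]
  exact Real.rpow_logb (by norm_num) (by norm_num) (sum_rpow_sum_rpow_pos ρ p hp0 hp1)

lemma two_rpow_mul_sub_logb (ρ h : ℝ) {c : ℕ} (hc : 0 < c) :
    (2 : ℝ) ^ (ρ * (h - Real.logb 2 c)) = (c : ℝ) ^ (-ρ) * 2 ^ (ρ * h) := by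
  have hc' : (0 : ℝ) < c := by exact_mod_cast hc
  rw [show ρ * (h - Real.logb 2 c) = Real.logb 2 c * (-ρ) + ρ * h by ring,
    Real.rpow_add two_pos, Real.rpow_mul two_pos.le, Real.rpow_logb two_pos (by norm_num) hc']

lemma bobGuessAmb_keyedEncoder_lt {𝒳 𝒴 K M₁ M₂ : Type*} [Fintype 𝒳] [Fintype 𝒴] [Fintype K]
    [Nonempty K] [Fintype M₁] [Fintype M₂] {ρ : ℝ} (hρ : 0 < ρ) (p : 𝒳 → 𝒴 → ℝ)
    (hp0 : ∀ x y, 0 ≤ p x y) (hp1 : ∑ x, ∑ y, p x y = 1) (g : 𝒴 → 𝒳 → ℕ) (hg : IsGuess g)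
    (hgp : ∀ y x, g y x ≤ (Finset.univ.filter fun x' => -p x' y ≤ -p x y).card)
    {c : ℕ} (hc : 0 < c) (enc : 𝒳 → 𝒴 → K → M₁ × M₂)
    (henc : ∀ y x x' u u', enc x y u = enc x' y u' → (g y x - 1) % c = (g y x' - 1) % c) :
    bobGuessAmb ρ p (keyedEncoder enc) <
      1 + 2 ^ ρ * (c : ℝ) ^ (-ρ) * ∑ y, (∑ x, p x y ^ (1 / (1 + ρ))) ^ (1 + ρ) := by
  choose G hG hGle using fun y =>
    exists_guess_of_residue_hint (g y) (hg y) c (fun x u => enc x y u) (henc y)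
  set D : ℝ := 2 ^ ρ * (c : ℝ) ^ (-ρ)
  have hD0 : 0 ≤ D := by positivity
  have hgpos (y x) : 0 < g y x := ((hg y).mapsTo (Set.mem_univ x)).1
  have hterm (x y u) : (G y (enc x y u) x : ℝ) ^ ρ ≤ ((((g y x - 1) / c + 1 : ℕ)) : ℝ) ^ ρ :=
    Real.rpow_le_rpow (by positivity) (by exact_mod_cast hGle y x u) hρ.le
  have hinner (x y) : ∑ m, p x y * keyedEncoder enc x y m * (G y m x : ℝ) ^ ρ ≤
      p x y * ((((g y x - 1) / c + 1 : ℕ)) : ℝ) ^ ρ := by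
    rw [sum_keyedEncoder_mul_mul enc x y (p x y) fun m => (G y m x : ℝ) ^ ρ]
    refine mul_le_mul_of_nonneg_left ?_ (hp0 x y)
    rw [inv_mul_le_iff₀ (Nat.cast_pos.2 Fintype.card_pos)]
    refine (Finset.sum_le_sum fun u _ => hterm x y u).trans (le_of_eq ?_)
    simp
  have hlt (x y) : p x y * ((((g y x - 1) / c + 1 : ℕ)) : ℝ) ^ ρ ≤
      p x y * (1 + D * (g y x : ℝ) ^ ρ) :=
    mul_le_mul_of_nonneg_left (rpow_nat_div_add_one_lt hρ _ _ (hgpos y x) hc).le (hp0 x y)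
  have hstrict : ∑ x, ∑ y, p x y * ((((g y x - 1) / c + 1 : ℕ)) : ℝ) ^ ρ <
      ∑ x, ∑ y, p x y * (1 + D * (g y x : ℝ) ^ ρ) := by
    obtain ⟨x, -, hx⟩ := Finset.exists_ne_zero_of_sum_ne_zero (hp1.trans_ne one_ne_zero)
    obtain ⟨y, -, hy⟩ := Finset.exists_ne_zero_of_sum_ne_zero hx
    refine Finset.sum_lt_sum (fun x _ => Finset.sum_le_sum fun y _ => hlt x y)
      ⟨x, Finset.mem_univ x, Finset.sum_lt_sum (fun y _ => hlt x y) ⟨y, Finset.mem_univ y, ?_⟩⟩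
    exact mul_lt_mul_of_pos_left (rpow_nat_div_add_one_lt hρ _ _ (hgpos y x) hc)
      ((hp0 x y).lt_of_ne' hy)
  have hsInf : bobGuessAmb ρ p (keyedEncoder enc) ≤
      ∑ x, ∑ y, ∑ m, p x y * keyedEncoder enc x y m * (G y m x : ℝ) ^ ρ := by
    refine csInf_le ⟨0, ?_⟩ ⟨fun v => G v.1 v.2, fun v => hG v.1 v.2, rfl⟩
    rintro r ⟨G', -, rfl⟩
    exact Finset.sum_nonneg fun x _ => Finset.sum_nonneg fun y _ => Finset.sum_nonneg fun m _ =>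
      mul_nonneg (mul_nonneg (hp0 x y) (keyedEncoder_nonneg enc x y m)) (by positivity)
  calc bobGuessAmb ρ p (keyedEncoder enc)
      ≤ ∑ x, ∑ y, p x y * ((((g y x - 1) / c + 1 : ℕ)) : ℝ) ^ ρ :=
        hsInf.trans (Finset.sum_le_sum fun x _ => Finset.sum_le_sum fun y _ => hinner x y)
    _ < ∑ x, ∑ y, p x y * (1 + D * (g y x : ℝ) ^ ρ) := hstrict
    _ = 1 + D * ∑ y, ∑ x, p x y * (g y x : ℝ) ^ ρ := by
        rw [Finset.sum_comm (s := (Finset.univ : Finset 𝒴))]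
        simp only [mul_add, mul_one, Finset.sum_add_distrib, hp1, Finset.mul_sum,
          mul_left_comm D]
    _ ≤ _ := by
        gcongr with y
        exact sum_mul_rpow_guess_le hρ (fun x => p x y) (fun x => hp0 x y) (g y) (hgp y)

lemma le_eveAmb_keyedEncoder_padHints {𝒳 𝒴 K A B M₁ M₂ : Type*} [Fintype 𝒳] [Fintype 𝒴]
    [Fintype K] [Fintype A] [Fintype B] [AddGroup K] [Nonempty A] [Fintype M₁] [Fintype M₂]
    {ρ : ℝ} (hρ : 0 < ρ) (p : 𝒳 → 𝒴 → ℝ) (hp0 : ∀ x y, 0 ≤ p x y)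
    (ι₁ : K × A ↪ M₁) (ι₂ : K × B ↪ M₂) (f : 𝒳 → 𝒴 → K × A × B) :
    (1 + Real.log (Fintype.card 𝒳)) ^ (-ρ) *
        (((Fintype.card A + Fintype.card B : ℕ) : ℝ) ^ (-ρ) *
          ∑ y, (∑ x, p x y ^ (1 / (1 + ρ))) ^ (1 + ρ)) ≤
      eveAmb ρ p (keyedEncoder fun x y => padHints ι₁ ι₂ (f x y)) := by
  obtain ⟨F₁, hF₁⟩ := exists_isGuess 𝒳 (𝒴 × M₁)
  obtain ⟨F₂, hF₂⟩ := exists_isGuess 𝒳 (𝒴 × M₂)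
  refine le_csInf ⟨_, F₁, F₂, hF₁, hF₂, rfl⟩ ?_
  rintro r ⟨G₁, G₂, hG₁, hG₂, rfl⟩
  have hL : 0 < 1 + Real.log (Fintype.card 𝒳) := by
    have := Real.log_natCast_nonneg (Fintype.card 𝒳)
    positivity
  have hC : (0 : ℝ) < ((Fintype.card A + Fintype.card B : ℕ) : ℝ) :=
    Nat.cast_pos.2 (Nat.add_pos_left Fintype.card_pos _)
  rw [mul_left_comm, ← mul_assoc, ← Real.mul_rpow hC.le hL.le,
    Real.rpow_neg (mul_pos hC hL).le,
    inv_mul_le_iff₀ (Real.rpow_pos_of_pos (mul_pos hC hL) _), mul_comm, Finset.sum_comm,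
    Finset.sum_mul]
  refine Finset.sum_le_sum fun y _ => ?_
  refine (rpow_sum_rpow_le_min_guess hρ (fun x => p x y) (fun x => hp0 x y) ι₁ ι₂
    (fun x => f x y) (fun m => G₁ (y, m)) (fun m => G₂ (y, m)) (fun m => hG₁ (y, m))
    (fun m => hG₂ (y, m))).trans (le_of_eq ?_)
  congr 1
  refine Finset.sum_congr rfl fun x _ => ?_
  rw [← sum_keyedEncoder_mul_mul (fun x y => padHints ι₁ ι₂ (f x y)) x y (p x y) fun m =>
    ((min (G₁ (y, m.1) x) (G₂ (y, m.2) x) : ℕ) : ℝ) ^ ρ, Fintype.sum_prod_type]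

/-- Theorem 5 (finite-blocklength guessing version), achievability part. -/
theorem distributed_storage_guessing_achievability
    {𝒳 𝒴 M₁ M₂ : Type*} [Fintype 𝒳] [Fintype 𝒴] [Fintype M₁] [Fintype M₂]
    (ρ : ℝ) (hρ : 0 < ρ)
    (p : 𝒳 → 𝒴 → ℝ) (hp0 : ∀ x y, 0 ≤ p x y) (hp1 : ∑ x : 𝒳, ∑ y : 𝒴, p x y = 1)
    (cs c₁ c₂ : ℕ) (hcs : 0 < cs) (hc₁ : 0 < c₁) (hc₂ : 0 < c₂)
    (hcs' : cs ≤ min (Fintype.card M₁) (Fintype.card M₂))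
    (hc₁' : c₁ ≤ Fintype.card M₁ / cs) (hc₂' : c₂ ≤ Fintype.card M₂ / cs) :
    ∃ e : 𝒳 → 𝒴 → M₁ × M₂ → ℝ,
      (∀ x y m, 0 ≤ e x y m) ∧ (∀ x y, ∑ m : M₁ × M₂, e x y m = 1) ∧
      bobGuessAmb ρ p e <
        1 + (2 : ℝ) ^ (ρ * (condRenyi ρ p - Real.logb 2 ((cs * c₁ * c₂ : ℕ) : ℝ) + 1)) ∧
      (1 + Real.log (Fintype.card 𝒳)) ^ (-ρ) *
          (2 : ℝ) ^ (ρ * (condRenyi ρ p - Real.logb 2 ((c₁ + c₂ : ℕ) : ℝ))) ≤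
        eveAmb ρ p e := by
  have : NeZero cs := ⟨hcs.ne'⟩
  have : NeZero c₁ := ⟨hc₁.ne'⟩
  have hc : 0 < cs * c₁ * c₂ := by positivity
  obtain ⟨ι₁⟩ : Nonempty (ZMod cs × Fin c₁ ↪ M₁) := Function.Embedding.nonempty_of_card_le <| by
    simpa [ZMod.card, mul_comm] using (Nat.le_div_iff_mul_le hcs).1 hc₁'
  obtain ⟨ι₂⟩ : Nonempty (ZMod cs × Fin c₂ ↪ M₂) := Function.Embedding.nonempty_of_card_le <| by
    simpa [ZMod.card, mul_comm] using (Nat.le_div_iff_mul_le hcs).1 hc₂'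
  let φ : Fin (cs * c₁ * c₂) ≃ ZMod cs × Fin c₁ × Fin c₂ :=
    Fintype.equivOfCardEq (by simp [ZMod.card, mul_assoc])
  choose g hg hgp using fun y => exists_bijOn_le_card fun x => -p x y
  let f (x : 𝒳) (y : 𝒴) : ZMod cs × Fin c₁ × Fin c₂ :=
    φ ⟨(g y x - 1) % (cs * c₁ * c₂), Nat.mod_lt _ hc⟩
  let enc (x : 𝒳) (y : 𝒴) : ZMod cs → M₁ × M₂ := padHints ι₁ ι₂ (f x y)
  refine ⟨keyedEncoder enc, keyedEncoder_nonneg enc, sum_keyedEncoder enc, ?_, ?_⟩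
  · have hbob := bobGuessAmb_keyedEncoder_lt hρ p hp0 hp1 g hg hgp hc enc
      fun y x x' u u' h => by simpa [f] using padHints_eq_imp ι₁ ι₂ h
    convert hbob using 2
    rw [mul_add, mul_one, Real.rpow_add two_pos, two_rpow_mul_sub_logb ρ _ hc,
      two_rpow_mul_condRenyi hρ p hp0 hp1]
    ring
  · have heve := le_eveAmb_keyedEncoder_padHints hρ p hp0 ι₁ ι₂ f
    rw [Fintype.card_fin, Fintype.card_fin] at heve
    rwa [two_rpow_mul_sub_logb ρ _ (Nat.add_pos_left hc₁ c₂),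
      two_rpow_mul_condRenyi hρ p hp0 hp1]
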